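/- Let N ≥ 4 be an integer, let p₁, …, p_m be distinct partitions of [k], and suppose ξ = ∑_{i=1}^m α_i ξ_{p_i} is nonzero. Suppose there exist a crossing κ ∈ ⋂_{i=1}^m cr(p_i), and an index j together with a crossing λ ∈ (⋂_{i ≠ j} cr(p_i)) ∖ cr(p_j). Then either α_j = 0 and the vector ∑_{i ≠ j} α_i ξ_{p_i} lies in ⟨NC, ξ⟩(0,k), or α_j ≠ 0 and ⟨NC, ξ⟩ = P (equality of families meaning equality of each subspace C(k',ℓ')). -/

import Mathlib

open scoped Classical

/-- The block relation of a finite partition of `Fin n` (partition of `[n]`):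
`x ∼_p y` iff `x` and `y` lie in the same block of `p`. -/
def PartRel {n : ℕ} (p : Finpartition (Finset.univ : Finset (Fin n))) (x y : Fin n) : Prop :=
  ∃ B ∈ p.parts, x ∈ B ∧ y ∈ B

/-- `κ` is a crossing of the relation `r`: `κ = {a,b,c,d}` with `a < b < c < d`,
`r a c`, `r b d`, and `¬ r a b`. -/
def IsCross {n : ℕ} (r : Fin n → Fin n → Prop) (κ : Finset (Fin n)) : Prop :=
  ∃ a b c d : Fin n, a < b ∧ b < c ∧ c < d ∧ κ = {a, b, c, d} ∧ r a c ∧ r b d ∧ ¬ r a b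

/-- `cr p`: the set of crossings of the partition `p`. -/
def cr {n : ℕ} (p : Finpartition (Finset.univ : Finset (Fin n))) : Set (Finset (Fin n)) :=
  {κ | IsCross (PartRel p) κ}


/-- `crossers p` (`χ(p)`): the union of all crossings of `p`. -/
def crossers {n : ℕ} (p : Finpartition (Finset.univ : Finset (Fin n))) : Set (Fin n) :=
  {x | ∃ κ ∈ cr p, x ∈ κ}

/-- The vector `ξ_p ∈ (ℂ^N)^{⊗k}`, identified with `(Fin k → Fin N) → ℂ`:
its coordinate at `i` is `1` if `i` is constant on every block of `p`, else `0`. -/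
noncomputable def xi (N : ℕ) {k : ℕ} (p : Finpartition (Finset.univ : Finset (Fin k))) :
    (Fin k → Fin N) → ℂ :=
  fun i => if ∀ x y, PartRel p x y → i x = i y then 1 else 0

/-- The span of the noncrossing-partition vectors `ξ_p`, `p ∈ NC(k)`. -/
noncomputable def ncSpan (N k : ℕ) : Submodule ℂ ((Fin k → Fin N) → ℂ) :=
  Submodule.span ℂ
    {v | ∃ p : Finpartition (Finset.univ : Finset (Fin k)), cr p = ∅ ∧ v = xi N p}

/-- The span of the crossing-partition vectors `ξ_p`, `p ∈ CR(k)`. -/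
noncomputable def crSpan (N k : ℕ) : Submodule ℂ ((Fin k → Fin N) → ℂ) :=
  Submodule.span ℂ
    {v | ∃ p : Finpartition (Finset.univ : Finset (Fin k)), (cr p).Nonempty ∧ v = xi N p}

/-- The span of all partition vectors `ξ_p`, `p ∈ P(k)`. -/
noncomputable def allSpan (N k : ℕ) : Submodule ℂ ((Fin k → Fin N) → ℂ) :=
  Submodule.span ℂ
    {v | ∃ p : Finpartition (Finset.univ : Finset (Fin k)), v = xi N p}

/-- Linear maps `(ℂ^N)^{⊗k} → (ℂ^N)^{⊗ℓ}`, as matrices with rows indexed by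
lower index tuples and columns by upper index tuples. -/
abbrev Mat (N k ℓ : ℕ) := Matrix (Fin ℓ → Fin N) (Fin k → Fin N) ℂ

/-- The tensor product of two such linear maps. -/
def tensorMat {N k ℓ k' ℓ' : ℕ} (S : Mat N k ℓ) (T : Mat N k' ℓ') :
    Mat N (k + k') (ℓ + ℓ') :=
  fun i j =>
    S (fun a => i (Fin.castAdd ℓ' a)) (fun b => j (Fin.castAdd k' b)) *
      T (fun a => i (Fin.natAdd ℓ a)) (fun b => j (Fin.natAdd k b))

/-- The cup: the map `(ℂ^N)^{⊗2} → ℂ` sending `e_i ⊗ e_j` to `δ_{ij}`. -/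
def cupMat (N : ℕ) : Mat N 2 0 := fun _ j => if j 0 = j 1 then 1 else 0

/-- A Tannaka–Krein dual at parameter `N`: a family of subspaces
`C k ℓ ⊆ Hom((ℂ^N)^{⊗k}, (ℂ^N)^{⊗ℓ})` closed under tensor products, composition
and adjoints, containing the identity of `ℂ^N` and the cup. -/
structure TKDual (N : ℕ) where
  C : ∀ k ℓ : ℕ, Submodule ℂ (Mat N k ℓ)
  tensor_mem : ∀ {k ℓ k' ℓ' : ℕ} {S : Mat N k ℓ} {T : Mat N k' ℓ'},
    S ∈ C k ℓ → T ∈ C k' ℓ' → tensorMat S T ∈ C (k + k') (ℓ + ℓ')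
  comp_mem : ∀ {k ℓ r : ℕ} {S : Mat N ℓ r} {T : Mat N k ℓ},
    S ∈ C ℓ r → T ∈ C k ℓ → S * T ∈ C k r
  adj_mem : ∀ {k ℓ : ℕ} {T : Mat N k ℓ}, T ∈ C k ℓ → T.conjTranspose ∈ C ℓ k
  id_mem : (1 : Matrix (Fin 1 → Fin N) (Fin 1 → Fin N) ℂ) ∈ C 1 1
  cup_mem : cupMat N ∈ C 2 0

/-- The involution of `Fin (k + ℓ)` fixing the first `k` (upper) points and
reversing the order of the last `ℓ` (lower) points. -/
def lowerRev (k ℓ : ℕ) : Fin (k + ℓ) → Fin (k + ℓ) :=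
  Fin.append (fun a : Fin k => Fin.castAdd ℓ a) (fun a : Fin ℓ => Fin.natAdd k a.rev)

/-- A partition of `[k + ℓ]` (first `k` points upper, last `ℓ` points lower) is
noncrossing when the partition obtained by reversing the order of the lower
points has no crossing. -/
def IsNCPart {k ℓ : ℕ} (p : Finpartition (Finset.univ : Finset (Fin (k + ℓ)))) : Prop :=
  ∀ κ, ¬ IsCross (fun x y => PartRel p (lowerRev k ℓ x) (lowerRev k ℓ y)) κ

/-- The linear map `T_p : (ℂ^N)^{⊗k} → (ℂ^N)^{⊗ℓ}` of a partition `p` of `[k + ℓ]`: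
its entry at (lower tuple `i`, upper tuple `j`) is `1` if the labelling of the points
of `p` by `j` on the upper points and `i` on the lower points is constant on each
block of `p`, and `0` otherwise. -/
noncomputable def Tmat (N : ℕ) (k ℓ : ℕ)
    (p : Finpartition (Finset.univ : Finset (Fin (k + ℓ)))) : Mat N k ℓ :=
  fun i j => if ∀ x y, PartRel p x y → Fin.append j i x = Fin.append j i y then 1 else 0

/-- The family `P(k,ℓ) = span{T_p : p a partition of [k+ℓ]}`. -/
noncomputable def Pfam (N k ℓ : ℕ) : Submodule ℂ (Mat N k ℓ) :=
  Submodule.span ℂ (Set.range (Tmat N k ℓ))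

/-- The family `NC(k,ℓ) = span{T_p : p a noncrossing partition of [k+ℓ]}`. -/
noncomputable def NCfam (N k ℓ : ℕ) : Submodule ℂ (Mat N k ℓ) :=
  Submodule.span ℂ {T | ∃ p, IsNCPart p ∧ T = Tmat N k ℓ p}

/-- A vector in `(ℂ^N)^{⊗k}` viewed as a linear map `(ℂ^N)^{⊗0} → (ℂ^N)^{⊗k}`. -/
def vecMat {N k : ℕ} (v : (Fin k → Fin N) → ℂ) : Mat N 0 k := fun i _ => v i

/-- `⟨NC, ξ⟩`: the smallest Tannaka–Krein dual containing all of `NC` together with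
the vector `ξ ∈ (ℂ^N)^{⊗k}` (in degree `(0,k)`), i.e. the intersection of all such. -/
noncomputable def genNCxi (N : ℕ) {k : ℕ} (ξ : (Fin k → Fin N) → ℂ) (k' ℓ' : ℕ) :
    Submodule ℂ (Mat N k' ℓ') :=
  ⨅ (C : TKDual N) (_ : ∀ a b, NCfam N a b ≤ C.C a b) (_ : vecMat ξ ∈ C.C 0 k),
    C.C k' ℓ'

theorem indicator_congr {p q : Prop} {_ : Decidable p} {_ : Decidable q} (h : p ↔ q) :
    (if p then 1 else 0 : ℂ) = if q then 1 else 0 :=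
  if_congr h rfl rfl

theorem partRel_iff {n : ℕ} (p : Finpartition (Finset.univ : Finset (Fin n))) (x y : Fin n) :
    PartRel p x y ↔ p.part x = p.part y := by
  rw [← p.mem_part_iff_part_eq_part (Finset.mem_univ x) (Finset.mem_univ y),
    p.mem_part_iff_exists]
  rfl

/-- The partition of `[n]` into the fibres of a labelling. -/
noncomputable def kerPart {n : ℕ} {ι : Type*} (f : Fin n → ι) :
    Finpartition (Finset.univ : Finset (Fin n)) :=
  Finpartition.ofSetoid (Setoid.ker f)

theorem partRel_kerPart {n : ℕ} {ι : Type*} (f : Fin n → ι) (x y : Fin n) :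
    PartRel (kerPart f) x y ↔ f x = f y := by
  rw [partRel_iff, ← Finpartition.mem_part_iff_part_eq_part _ (Finset.mem_univ x)
    (Finset.mem_univ y), kerPart, Finpartition.mem_part_ofSetoid_iff_rel, Setoid.ker_def, eq_comm]

/-- The partition matrix attached to the fibres of a labelling of the points. -/
noncomputable def labMat (N : ℕ) {k ℓ : ℕ} {ι : Type*} (f : Fin (k + ℓ) → ι) : Mat N k ℓ :=
  fun i j => if ∀ x y, f x = f y → Fin.append j i x = Fin.append j i y then 1 else 0

theorem Tmat_kerPart (N : ℕ) {k ℓ : ℕ} {ι : Type*} (f : Fin (k + ℓ) → ι) :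
    Tmat N k ℓ (kerPart f) = labMat N f := by
  ext i j
  simp only [Tmat, labMat, partRel_kerPart]

theorem labMat_mem_NCfam (N : ℕ) {k ℓ : ℕ} {ι : Type*} (f : Fin (k + ℓ) → ι)
    (hf : ∀ a b c d, a < b → b < c → c < d →
      f (lowerRev k ℓ a) = f (lowerRev k ℓ c) → f (lowerRev k ℓ b) = f (lowerRev k ℓ d) →
      f (lowerRev k ℓ a) = f (lowerRev k ℓ b)) :
    labMat N f ∈ NCfam N k ℓ := by
  refine Submodule.subset_span ⟨kerPart f, ?_, (Tmat_kerPart N f).symm⟩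
  rintro κ ⟨a, b, c, d, hab, hbc, hcd, -, hac, hbd, hnab⟩
  simp only [partRel_kerPart] at hac hbd hnab
  exact hnab (hf a b c d hab hbc hcd hac hbd)

theorem append_lowerRev_unimodal {k ℓ : ℕ} {ι : Type*} [LinearOrder ι] {u : Fin k → ι}
    {w : Fin ℓ → ι} (hu : Monotone u) (hw : Monotone w) {a b c : Fin (k + ℓ)}
    (hab : a < b) (hbc : b < c) :
    Fin.append u w (lowerRev k ℓ a) ≤ Fin.append u w (lowerRev k ℓ b) ∨
      Fin.append u w (lowerRev k ℓ c) ≤ Fin.append u w (lowerRev k ℓ b) := by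
  have hl : ∀ x : Fin k, lowerRev k ℓ (Fin.castAdd ℓ x) = Fin.castAdd ℓ x := by
    simp [lowerRev]
  have hr : ∀ x : Fin ℓ, lowerRev k ℓ (Fin.natAdd k x) = Fin.natAdd k x.rev := by
    simp [lowerRev]
  induction b using Fin.addCases with
  | left b =>
    left
    induction a using Fin.addCases with
    | left a =>
      simp only [hl, Fin.append_left]
      exact hu hab.le
    | right a => simp [Fin.lt_def] at hab; omega
  | right b =>
    right
    induction c using Fin.addCases with
    | left c => simp [Fin.lt_def] at hbc; omega
    | right c =>
      simp only [hr, Fin.append_right]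
      exact hw (Fin.rev_le_rev.2 (by simpa using hbc.le))

theorem labMat_append_mem_NCfam (N : ℕ) {k ℓ : ℕ} {ι : Type*} [LinearOrder ι] {u : Fin k → ι}
    {w : Fin ℓ → ι} (hu : Monotone u) (hw : Monotone w) :
    labMat N (Fin.append u w) ∈ NCfam N k ℓ := by
  refine labMat_mem_NCfam N _ fun a b c d hab hbc hcd hac hbd => le_antisymm ?_ ?_
  · rcases append_lowerRev_unimodal hu hw hab hbc with h | h
    · exact h
    · exact hac.trans_le h
  · rcases append_lowerRev_unimodal hu hw hbc hcd with h | h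
    · exact h.trans_eq hac.symm
    · exact (hbd.trans_le h).trans_eq hac.symm

/-- Selecting coordinates along a monotone map and summing out the others. -/
noncomputable def selectMat (N : ℕ) {k ℓ : ℕ} (g : Fin ℓ → Fin k) : Mat N k ℓ :=
  fun i j => if j ∘ g = i then 1 else 0

theorem selectMat_mem_NCfam (N : ℕ) {k ℓ : ℕ} {g : Fin ℓ → Fin k} (hg : Monotone g) :
    selectMat N g ∈ NCfam N k ℓ := by
  convert labMat_append_mem_NCfam N (monotone_id (α := Fin k)) hg using 1
  ext i j
  refine indicator_congr ⟨?_, fun h => ?_⟩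
  · rintro rfl x y hxy
    have key : ∀ x, Fin.append j (j ∘ g) x = j (Fin.append id g x) := fun x => by
      induction x using Fin.addCases <;> simp
    rw [key, key, hxy]
  · funext t
    simpa using h (Fin.castAdd ℓ (g t)) (Fin.natAdd k t) (by simp)

theorem one_mem_of_NCfam_le {N : ℕ} {C : TKDual N} (hC : ∀ a b, NCfam N a b ≤ C.C a b) (n : ℕ) :
    (1 : Mat N n n) ∈ C.C n n := by
  convert hC _ _ (selectMat_mem_NCfam N (monotone_id (α := Fin n))) using 1
  ext i j
  simp only [Matrix.one_apply, selectMat, Function.comp_id, eq_comm]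

/-- The flip of `ℂ^N ⊗ ℂ^N`. -/
noncomputable def flipMat (N : ℕ) : Mat N 2 2 :=
  fun i j => if i 0 = j 1 ∧ i 1 = j 0 then 1 else 0

/-- The action of a permutation of the tensor factors. -/
noncomputable def permMat (N : ℕ) {n : ℕ} (σ : Equiv.Perm (Fin n)) : Mat N n n :=
  fun i j => if j = i ∘ σ then 1 else 0

theorem permMat_mul (N : ℕ) {k n : ℕ} (σ : Equiv.Perm (Fin n)) (M : Mat N k n) :
    permMat N σ * M = fun i j => M (i ∘ σ) j := by
  ext i j
  simp [Matrix.mul_apply, permMat]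

theorem permMat_swap_mem {N : ℕ} {C : TKDual N} (hC : ∀ a b, NCfam N a b ≤ C.C a b)
    (hflip : flipMat N ∈ C.C 2 2) {a b n : ℕ} (h : a + 2 + b = n) :
    permMat N (Equiv.swap (⟨a, by omega⟩ : Fin n) ⟨a + 1, by omega⟩) ∈ C.C n n := by
  subst h
  convert C.tensor_mem (C.tensor_mem (one_mem_of_NCfam_le hC a) hflip)
    (one_mem_of_NCfam_le hC b) using 1
  ext i j
  simp only [permMat, tensorMat, Matrix.one_apply, flipMat, ← ite_and, mul_ite, mul_one, mul_zero]
  refine indicator_congr ?_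
  set s := Equiv.swap (⟨a, by omega⟩ : Fin (a + 2 + b)) ⟨a + 1, by omega⟩ with hs
  have hleft : ∀ x : Fin a, s (Fin.castAdd b (Fin.castAdd 2 x)) = Fin.castAdd b (Fin.castAdd 2 x) :=
    fun x => Equiv.swap_apply_of_ne_of_ne (by simp [Fin.ext_iff]; omega)
      (by simp [Fin.ext_iff]; omega)
  have hright : ∀ x : Fin b, s (Fin.natAdd (a + 2) x) = Fin.natAdd (a + 2) x :=
    fun x => Equiv.swap_apply_of_ne_of_ne (by simp [Fin.ext_iff]; omega)
      (by simp [Fin.ext_iff]; omega)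
  have h0 : s (Fin.castAdd b (Fin.natAdd a 0)) = Fin.castAdd b (Fin.natAdd a 1) :=
    Equiv.swap_apply_left _ _
  have h1 : s (Fin.castAdd b (Fin.natAdd a 1)) = Fin.castAdd b (Fin.natAdd a 0) :=
    Equiv.swap_apply_right _ _
  clear_value s
  constructor
  · rintro rfl
    simp [hleft, hright, h0, h1]
  · rintro h
    simp only [funext_iff] at h
    funext x
    induction x using Fin.addCases with
    | right x => simp_all
    | left x =>
      induction x using Fin.addCases with
      | left x => simp_all
      | right x => fin_cases x <;> simp_all

theorem perm_comp_mem {N : ℕ} {C : TKDual N} (hC : ∀ a b, NCfam N a b ≤ C.C a b)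
    (hflip : flipMat N ∈ C.C 2 2) {n : ℕ} (σ : Equiv.Perm (Fin n)) {k : ℕ} {M : Mat N k n}
    (hM : M ∈ C.C k n) : (fun i j => M (i ∘ σ) j : Mat N k n) ∈ C.C k n := by
  cases n with
  | zero => rwa [Subsingleton.elim σ 1]
  | succ n =>
    have hσ : σ ∈ Submonoid.closure
        (Set.range fun i : Fin n => Equiv.swap i.castSucc i.succ) := by
      rw [Equiv.Perm.mclosure_swap_castSucc_succ]; trivial
    induction hσ using Submonoid.closure_induction generalizing M with
    | mem x hx =>
      obtain ⟨i, rfl⟩ := hx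
      rw [← permMat_mul]
      exact C.comp_mem (permMat_swap_mem hC hflip (a := i) (b := n - 1 - i) (by omega)) hM
    | one => exact hM
    | mul x y _ _ hx hy => exact hx (hy hM)

theorem perm_comp_comp_mem {N : ℕ} {C : TKDual N} (hC : ∀ a b, NCfam N a b ≤ C.C a b)
    (hflip : flipMat N ∈ C.C 2 2) {k n : ℕ} (σ : Equiv.Perm (Fin n)) (τ : Equiv.Perm (Fin k))
    {M : Mat N k n} (hM : M ∈ C.C k n) :
    (fun i j => M (i ∘ σ) (j ∘ τ) : Mat N k n) ∈ C.C k n := by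
  have h := C.adj_mem (perm_comp_mem hC hflip τ (C.adj_mem (perm_comp_mem hC hflip σ hM)))
  refine (congrArg (· ∈ C.C k n) ?_).mpr h
  ext i j
  exact (star_star _).symm

theorem Pfam_le_of_flip_mem {N : ℕ} {C : TKDual N} (hC : ∀ a b, NCfam N a b ≤ C.C a b)
    (hflip : flipMat N ∈ C.C 2 2) (k ℓ : ℕ) : Pfam N k ℓ ≤ C.C k ℓ := by
  refine Submodule.span_le.2 ?_
  rintro _ ⟨p, rfl⟩
  obtain ⟨f, hf⟩ : ∃ f : Fin (k + ℓ) → Fin (k + ℓ), ∀ x y, PartRel p x y ↔ f x = f y := by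
    refine ⟨fun x => (Quotient.mk (Setoid.ker p.part) x).out, fun x y => ?_⟩
    rw [partRel_iff, Quotient.out_inj, Quotient.eq, Setoid.ker_def]
  let τ := Tuple.sort (f ∘ Fin.castAdd ℓ)
  let σ := Tuple.sort (f ∘ Fin.natAdd k)
  have hmem := perm_comp_comp_mem hC hflip σ τ (hC _ _ (labMat_append_mem_NCfam N
    (Tuple.monotone_sort (f ∘ Fin.castAdd ℓ)) (Tuple.monotone_sort (f ∘ Fin.natAdd k))))
  refine (congrArg (· ∈ C.C k ℓ) ?_).mpr hmem
  ext i j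
  let e : Fin (k + ℓ) → Fin (k + ℓ) := Fin.append (Fin.castAdd ℓ ∘ τ) (Fin.natAdd k ∘ σ)
  have he : Function.Surjective e := fun x => by
    induction x using Fin.addCases with
    | left x => exact ⟨Fin.castAdd ℓ (τ.symm x), by simp [e]⟩
    | right x => exact ⟨Fin.natAdd k (σ.symm x), by simp [e]⟩
  have h1 : ∀ x, Fin.append ((f ∘ Fin.castAdd ℓ) ∘ τ) ((f ∘ Fin.natAdd k) ∘ σ) x = f (e x) :=
    fun x => by induction x using Fin.addCases <;> simp [e]
  have h2 : ∀ x, Fin.append (j ∘ τ) (i ∘ σ) x = Fin.append j i (e x) :=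
    fun x => by induction x using Fin.addCases <;> simp [e]
  refine indicator_congr ?_
  simp only [hf]
  rw [he.forall₂]
  simp only [← h1, ← h2]
  rfl

/-- The vector of the crossing partition `{{0, 2}, {1, 3}}` of four points. -/
noncomputable def crossVec (N : ℕ) : (Fin 4 → Fin N) → ℂ :=
  fun i => if i 0 = i 2 ∧ i 1 = i 3 then 1 else 0

theorem flipMat_mem_of_crossVec_mem {N : ℕ} {C : TKDual N} (hC : ∀ a b, NCfam N a b ≤ C.C a b)
    (hcross : vecMat (crossVec N) ∈ C.C 0 4) : flipMat N ∈ C.C 2 2 := by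
  let f : Fin (6 + 2) → Fin 4 := ![0, 1, 1, 0, 2, 3, 2, 3]
  have hE : (labMat N f : Mat N 6 2) ∈ C.C 6 2 :=
    hC _ _ (labMat_mem_NCfam N f (by decide))
  have hmem := C.comp_mem hE (C.tensor_mem (one_mem_of_NCfam_le hC 2) hcross)
  refine (congrArg (· ∈ C.C 2 2) ?_).mpr hmem
  have hlab : ∀ (i : Fin 2 → Fin N) (x : Fin 6 → Fin N), (labMat N f : Mat N 6 2) i x =
      if x 0 = x 3 ∧ x 1 = x 2 ∧ i 0 = x 4 ∧ i 1 = x 5 then 1 else 0 := by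
    intro i x
    have e0 : (Fin.append x i : Fin (6 + 2) → Fin N) =
        ![x 0, x 1, x 2, x 3, x 4, x 5, i 0, i 1] := by
      funext t; fin_cases t <;> rfl
    refine indicator_congr ?_
    rw [e0]
    constructor
    · intro h
      exact ⟨h 0 3 rfl, h 1 2 rfl, h 6 4 rfl, h 7 5 rfl⟩
    · rintro ⟨h1, h2, h3, h4⟩ a b hab
      fin_cases a <;> fin_cases b <;>
        first | rfl | (simp_all; done) | (exact absurd hab (by decide))
  have hvec : ∀ (x : Fin 6 → Fin N) (j : Fin 2 → Fin N),
      tensorMat (1 : Mat N 2 2) (vecMat (crossVec N)) x j =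
      if x 0 = j 0 ∧ x 1 = j 1 ∧ x 2 = x 4 ∧ x 3 = x 5 then 1 else 0 := by
    intro x j
    simp only [tensorMat, Matrix.one_apply, vecMat, crossVec, ← ite_and, mul_ite, mul_one, mul_zero]
    refine indicator_congr ?_
    rw [funext_iff, Fin.forall_fin_two]
    constructor
    · rintro ⟨⟨a, b⟩, c, d⟩
      exact ⟨c, d, a, b⟩
    · rintro ⟨c, d, a, b⟩
      exact ⟨⟨a, b⟩, c, d⟩
  ext i j
  rw [Matrix.mul_apply]
  simp only [hlab]
  rw [Finset.sum_eq_single (![j 0, j 1, j 1, j 0, j 1, j 0] : Fin 6 → Fin N)]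
  · rw [hvec]
    simp [flipMat]
  · intro x _ hx
    rw [hvec]
    rw [ite_zero_mul_ite_zero, if_neg]
    rintro ⟨⟨h1, h2, -, -⟩, h3, h4, h5, h6⟩
    refine hx (funext fun t => ?_)
    fin_cases t
    · exact h3
    · exact h4
    · exact h2.symm.trans h4
    · exact h1.symm.trans h3
    · exact h5.symm.trans (h2.symm.trans h4)
    · exact h6.symm.trans (h1.symm.trans h3)
  · simp

/-- The matrices invariant under the simultaneous action of the permutations of `[N]`. -/
def invFam (N k ℓ : ℕ) : Submodule ℂ (Mat N k ℓ) where
  carrier := {M | ∀ (σ : Equiv.Perm (Fin N)) i j, M (σ ∘ i) (σ ∘ j) = M i j}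
  add_mem' hS hT σ i j := by simp [hS σ i j, hT σ i j]
  zero_mem' σ i j := rfl
  smul_mem' c S hS σ i j := by simp [hS σ i j]

theorem exists_perm_comp_eq {ι α : Type*} [Fintype α] {x y : ι → α}
    (h : Setoid.ker x = Setoid.ker y) : ∃ σ : Equiv.Perm α, σ ∘ x = y := by
  let e : {a // a ∈ Set.range x} ≃ {a // a ∈ Set.range y} :=
    (Setoid.quotientKerEquivRange x).symm.trans
      ((Quotient.congrRight fun a b => by rw [h]).trans (Setoid.quotientKerEquivRange y))
  refine ⟨e.extendSubtype, funext fun t => ?_⟩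
  rw [Function.comp_apply, e.extendSubtype_apply_of_mem _ ⟨t, rfl⟩]
  have : (Setoid.quotientKerEquivRange x).symm ⟨x t, t, rfl⟩ = Quotient.mk _ t := by
    rw [Equiv.symm_apply_eq]; rfl
  simp only [e, Equiv.trans_apply, this]
  rfl

theorem comp_append {k ℓ : ℕ} {α β : Type*} (f : α → β) (j : Fin k → α) (i : Fin ℓ → α) :
    Fin.append (f ∘ j) (f ∘ i) = f ∘ Fin.append j i := by
  funext x
  induction x using Fin.addCases <;> simp

theorem Pfam_le_invFam (N k ℓ : ℕ) : Pfam N k ℓ ≤ invFam N k ℓ := by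
  refine Submodule.span_le.2 ?_
  rintro _ ⟨p, rfl⟩ σ i j
  refine indicator_congr ?_
  simp only [comp_append, Function.comp_apply, σ.injective.eq_iff]

theorem finite_setoid (α : Type*) [Finite α] : Finite (Setoid α) :=
  Finite.of_injective (fun s : Setoid α => s.r) fun _ _ h => Setoid.ext fun a b =>
    iff_of_eq (congrFun₂ h a b)

/-- The indicator of the pairs of tuples whose joint kernel is exactly `s`. -/
noncomputable def orbitMat (N : ℕ) {k ℓ : ℕ} (s : Setoid (Fin (k + ℓ))) : Mat N k ℓ :=
  fun i j => if Setoid.ker (Fin.append j i) = s then 1 else 0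

theorem orbitMat_mem_Pfam (N : ℕ) {k ℓ : ℕ} (s : Setoid (Fin (k + ℓ))) :
    orbitMat N s ∈ Pfam N k ℓ := by
  have := finite_setoid (Fin (k + ℓ))
  have : Fintype (Setoid (Fin (k + ℓ))) := Fintype.ofFinite _
  induction s using WellFoundedGT.induction with
  | ind s ih =>
    have hs : Tmat N k ℓ (Finpartition.ofSetoid s) =
        orbitMat N s + ∑ t with s < t, orbitMat N t := by
      ext i j
      have hT : Tmat N k ℓ (Finpartition.ofSetoid s) i j =
          if s ≤ Setoid.ker (Fin.append j i) then 1 else 0 := by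
        refine indicator_congr ?_
        simp only [partRel_iff, ← Finpartition.mem_part_iff_part_eq_part _ (Finset.mem_univ _)
          (Finset.mem_univ _), Finpartition.mem_part_ofSetoid_iff_rel]
        exact ⟨fun h a b hab => h a b (s.symm hab), fun h a b hab => h (s.symm hab)⟩
      rw [hT, Matrix.add_apply, Matrix.sum_apply]
      simp only [orbitMat, Finset.sum_ite_eq, Finset.mem_filter, Finset.mem_univ, true_and]
      rcases eq_or_ne (Setoid.ker (Fin.append j i)) s with h | h
      · simp [h]
      · simp [h, lt_iff_le_and_ne, h.symm]
    rw [eq_sub_of_add_eq hs.symm]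
    refine sub_mem (Submodule.subset_span ⟨_, rfl⟩) (sum_mem fun t ht => ih t ?_)
    simpa using ht

theorem invFam_eq_Pfam (N k ℓ : ℕ) : invFam N k ℓ = Pfam N k ℓ := by
  refine le_antisymm (fun M hM => ?_) (Pfam_le_invFam N k ℓ)
  have := finite_setoid (Fin (k + ℓ))
  have : Fintype (Setoid (Fin (k + ℓ))) := Fintype.ofFinite _
  have hc : ∃ c : Setoid (Fin (k + ℓ)) → ℂ,
      ∀ i j, c (Setoid.ker (Fin.append j i)) = M i j := by
    refine ⟨fun s => if h : ∃ ij : (Fin ℓ → Fin N) × (Fin k → Fin N),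
      Setoid.ker (Fin.append ij.2 ij.1) = s then M h.choose.1 h.choose.2 else 0, fun i j => ?_⟩
    have h : ∃ ij : (Fin ℓ → Fin N) × (Fin k → Fin N),
      Setoid.ker (Fin.append ij.2 ij.1) = Setoid.ker (Fin.append j i) := ⟨(i, j), rfl⟩
    refine (dif_pos h).trans ?_
    obtain ⟨σ, hσ⟩ := exists_perm_comp_eq h.choose_spec
    rw [← comp_append] at hσ
    have hi : σ ∘ h.choose.1 = i := funext fun t => by
      simpa using congrFun hσ (Fin.natAdd k t)
    have hj : σ ∘ h.choose.2 = j := funext fun t => by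
      simpa using congrFun hσ (Fin.castAdd ℓ t)
    rw [← hM σ, hi, hj]
  obtain ⟨c, hc⟩ := hc
  have : M = ∑ s, c s • orbitMat N s := by
    ext i j
    simp [Matrix.sum_apply, orbitMat, hc]
  rw [this]
  exact sum_mem fun s _ => Submodule.smul_mem _ _ (orbitMat_mem_Pfam N s)

/-- The Tannaka–Krein dual of all permutation-invariant matrices. -/
def invTKDual (N : ℕ) : TKDual N where
  C := invFam N
  tensor_mem hS hT σ i j := congrArg₂ (· * ·) (hS σ _ _) (hT σ _ _)
  comp_mem {k ℓ r S T} hS hT σ i j := by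
    rw [Matrix.mul_apply, Matrix.mul_apply]
    refine (Fintype.sum_equiv (Equiv.arrowCongr (Equiv.refl (Fin ℓ)) σ) _ _ fun x => ?_).symm
    have hx : Equiv.arrowCongr (Equiv.refl (Fin ℓ)) σ x = σ ∘ x := rfl
    rw [hx, hS σ, hT σ]
  adj_mem hT σ i j := congrArg star (hT σ j i)
  id_mem σ i j := by
    simp [Matrix.one_apply, σ.injective.comp_left.eq_iff]
  cup_mem σ i j := by simp [cupMat]

theorem NCfam_le_Pfam (N k ℓ : ℕ) : NCfam N k ℓ ≤ Pfam N k ℓ := by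
  refine Submodule.span_mono ?_
  rintro _ ⟨p, -, rfl⟩
  exact ⟨p, rfl⟩

theorem vecMat_xi_mem_Pfam (N : ℕ) {k : ℕ} (p : Finpartition (Finset.univ : Finset (Fin k))) :
    vecMat (xi N p) ∈ Pfam N 0 k := by
  rw [← invFam_eq_Pfam]
  intro σ i j
  refine indicator_congr ?_
  simp only [Function.comp_apply, σ.injective.eq_iff]

theorem card_extensions {α β ι : Type*} [Finite β] (h : α → β) (i : α → ι) :
    Nat.card {x : β → ι // x ∘ h = i} =
      if ∀ a b, h a = h b → i a = i b then Nat.card ι ^ (Set.range h)ᶜ.ncard else 0 := by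
  split_ifs with hi
  · let x₀ : {b // b ∈ Set.range h} → ι := fun b => i b.2.choose
    have hx₀ : ∀ a, x₀ ⟨h a, a, rfl⟩ = i a := fun a =>
      hi _ _ (Exists.choose_spec (p := fun y => h y = h a) ⟨a, rfl⟩)
    have he : ∀ x : β → ι, x ∘ h = i ↔ x ∘ Subtype.val = x₀ := by
      intro x
      constructor
      · rintro rfl
        funext ⟨_, a, rfl⟩
        exact (hx₀ a).symm
      · intro hx
        funext a
        exact (congrFun hx ⟨h a, a, rfl⟩).trans (hx₀ a)
    rw [Nat.card_congr ((Equiv.subtypeEquivRight he).trans (Equiv.subtypePreimage _ x₀)),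
      Nat.card_fun]
    rfl
  · rw [Nat.card_eq_zero]
    refine Or.inl ⟨fun ⟨x, hx⟩ => hi ?_⟩
    rintro a b hab
    rw [← hx, Function.comp_apply, hab, Function.comp_apply]

/-- The equivalence relation of a partition of `[n]`. -/
def blockSetoid {n : ℕ} (p : Finpartition (Finset.univ : Finset (Fin n))) : Setoid (Fin n) :=
  Setoid.ker p.part

theorem blockSetoid_mk_eq {n : ℕ} (p : Finpartition (Finset.univ : Finset (Fin n))) (x y : Fin n) :
    Quotient.mk (blockSetoid p) x = Quotient.mk (blockSetoid p) y ↔ PartRel p x y := by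
  rw [Quotient.eq, partRel_iff]
  rfl

/-- The number of blocks of `p` not meeting the image of `g`. -/
noncomputable def freeBlocks {k ℓ : ℕ} (p : Finpartition (Finset.univ : Finset (Fin k)))
    (g : Fin ℓ → Fin k) : ℕ :=
  (Set.range (Quotient.mk (blockSetoid p) ∘ g))ᶜ.ncard

/-- The vector of the restriction of `p` along `g`. -/
noncomputable def restrictVec (N : ℕ) {k ℓ : ℕ} (p : Finpartition (Finset.univ : Finset (Fin k)))
    (g : Fin ℓ → Fin k) : (Fin ℓ → Fin N) → ℂ :=
  fun i => if ∀ a b, PartRel p (g a) (g b) → i a = i b then 1 else 0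

theorem selectMat_mul_vecMat_xi (N : ℕ) {k ℓ : ℕ}
    (p : Finpartition (Finset.univ : Finset (Fin k))) (g : Fin ℓ → Fin k) :
    selectMat N g * vecMat (xi N p) =
      ((N : ℂ) ^ freeBlocks p g) • vecMat (restrictVec N p g) := by
  ext i j
  let e : {x : Fin k → Fin N // x ∘ g = i ∧ ∀ a b, PartRel p a b → x a = x b} ≃
      {y : Quotient (blockSetoid p) → Fin N // y ∘ (Quotient.mk (blockSetoid p) ∘ g) = i} :=
    { toFun := fun x => ⟨Quotient.lift x.1 fun a b hab =>
        x.2.2 a b ((blockSetoid_mk_eq p a b).1 (Quotient.sound hab)), x.2.1⟩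
      invFun := fun y => ⟨y.1 ∘ Quotient.mk _, y.2, fun a b hab =>
        congrArg y.1 ((blockSetoid_mk_eq p a b).2 hab)⟩
      left_inv := fun x => rfl
      right_inv := fun y => Subtype.ext (funext fun q => by
        induction q using Quotient.inductionOn with | h a => rfl) }
  rw [Matrix.mul_apply]
  simp only [selectMat, vecMat, xi, ite_zero_mul_ite_zero, mul_one, Finset.sum_boole]
  rw [← Fintype.card_subtype, ← Nat.card_eq_fintype_card, Nat.card_congr e, card_extensions]
  simp [blockSetoid_mk_eq, restrictVec, freeBlocks, vecMat]

theorem vecMat_restrictVec_mem_NCfam (N : ℕ) {k : ℕ}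
    (p : Finpartition (Finset.univ : Finset (Fin k))) (g : Fin 4 → Fin k)
    (hg : ¬ (PartRel p (g 0) (g 2) ∧ PartRel p (g 1) (g 3) ∧ ¬ PartRel p (g 0) (g 1))) :
    vecMat (restrictVec N p g) ∈ NCfam N 0 4 := by
  let f : Fin (0 + 4) → Finset (Fin k) := Fin.append Fin.elim0 (p.part ∘ g)
  have hf : ∀ x, f (Fin.natAdd 0 x) = p.part (g x) := Fin.append_right _ _
  have hrev : ∀ x : Fin 4, lowerRev 0 4 (Fin.natAdd 0 x) = Fin.natAdd 0 x.rev :=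
    Fin.append_right _ _
  have hall : ∀ P : Fin (0 + 4) → Prop, (∀ x : Fin 4, P (Fin.natAdd 0 x)) → ∀ x, P x :=
    fun P hP x => by
      induction x using Fin.addCases with
      | left x => exact x.elim0
      | right x => exact hP x
  have hmem : labMat N f ∈ NCfam N 0 4 := by
    refine labMat_mem_NCfam N f ?_
    refine hall _ fun a => hall _ fun b => hall _ fun c => hall _ fun d => ?_
    intro hab hbc hcd
    simp only [Fin.lt_def, Fin.val_natAdd] at hab hbc hcd
    obtain rfl : a = 0 := by omega
    obtain rfl : b = 1 := by omega
    obtain rfl : c = 2 := by omega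
    obtain rfl : d = 3 := by omega
    simp only [hrev, hf, ← partRel_iff]
    simp only [partRel_iff] at hg ⊢
    intro h1 h2
    by_contra h3
    exact hg ⟨h2.symm, h1.symm, fun h => h3 (h1.trans (h.symm.trans h2.symm))⟩
  refine (congrArg (· ∈ NCfam N 0 4) ?_).mpr hmem
  ext i j
  have happ : ∀ x, Fin.append j i (Fin.natAdd 0 x) = i x := Fin.append_right _ _
  refine indicator_congr ?_
  simp only [partRel_iff]
  constructor
  · intro h
    refine hall _ fun a => hall _ fun b => ?_
    simpa only [hf, happ] using h a b
  · intro h a b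
    simpa only [hf, happ] using h (Fin.natAdd 0 a) (Fin.natAdd 0 b)

theorem restrictVec_eq_crossVec (N : ℕ) {k : ℕ} {p : Finpartition (Finset.univ : Finset (Fin k))}
    {g : Fin 4 → Fin k} (h02 : PartRel p (g 0) (g 2)) (h13 : PartRel p (g 1) (g 3))
    (h01 : ¬ PartRel p (g 0) (g 1)) : restrictVec N p g = crossVec N := by
  funext i
  refine indicator_congr ⟨fun h => ⟨h 0 2 h02, h 1 3 h13⟩, ?_⟩
  simp only [partRel_iff] at *
  rintro ⟨h1, h2⟩ a b hab
  fin_cases a <;> fin_cases b <;> simp_all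

theorem freeBlocks_of_cross {k : ℕ} {p : Finpartition (Finset.univ : Finset (Fin k))}
    {g : Fin 4 → Fin k} (h02 : PartRel p (g 0) (g 2)) (h13 : PartRel p (g 1) (g 3))
    (h01 : ¬ PartRel p (g 0) (g 1)) :
    freeBlocks p g = Nat.card (Quotient (blockSetoid p)) - 2 := by
  rw [← blockSetoid_mk_eq] at h02 h13 h01
  have hrange : Set.range (Quotient.mk (blockSetoid p) ∘ g) =
      {Quotient.mk _ (g 0), Quotient.mk _ (g 1)} := by
    ext q
    simp only [Set.mem_range, Function.comp_apply, Fin.exists_fin_succ, Set.mem_insert_iff,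
      Set.mem_singleton_iff]
    grind
  have h := Set.ncard_add_ncard_compl (Set.range (Quotient.mk (blockSetoid p) ∘ g))
  have h2 : (Set.range (Quotient.mk (blockSetoid p) ∘ g)).ncard = 2 := by
    rw [hrange, Set.ncard_pair h01]
  rw [freeBlocks]
  omega

theorem card_eq_four_of_isCross {n : ℕ} {r : Fin n → Fin n → Prop} {κ : Finset (Fin n)}
    (h : IsCross r κ) : κ.card = 4 := by
  obtain ⟨a, b, c, d, hab, hbc, hcd, rfl, -⟩ := h
  have hac := hab.trans hbc
  have hbd := hbc.trans hcd
  have had := hab.trans hbd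
  simp [Finset.card_insert_of_notMem, hab.ne, hac.ne, had.ne, hbc.ne, hbd.ne, hcd.ne]

theorem isCross_iff {n : ℕ} {r : Fin n → Fin n → Prop} {κ : Finset (Fin n)} (h : κ.card = 4) :
    IsCross r κ ↔ r (κ.orderEmbOfFin h 0) (κ.orderEmbOfFin h 2) ∧
      r (κ.orderEmbOfFin h 1) (κ.orderEmbOfFin h 3) ∧
      ¬ r (κ.orderEmbOfFin h 0) (κ.orderEmbOfFin h 1) := by
  constructor
  · rintro ⟨a, b, c, d, hab, hbc, hcd, hκ, hac, hbd, hnab⟩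
    have hg := Finset.orderEmbOfFin_unique h (f := ![a, b, c, d])
      (fun x => by fin_cases x <;> simp [hκ])
      (Fin.strictMono_iff_lt_succ.2 fun x => by fin_cases x <;> assumption)
    rw [← hg]
    exact ⟨hac, hbd, hnab⟩
  · rintro ⟨h1, h2, h3⟩
    refine ⟨_, _, _, _, (κ.orderEmbOfFin h).strictMono (by decide : (0 : Fin 4) < 1),
      (κ.orderEmbOfFin h).strictMono (by decide : (1 : Fin 4) < 2),
      (κ.orderEmbOfFin h).strictMono (by decide : (2 : Fin 4) < 3), ?_, h1, h2, h3⟩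
    have hmem : ∀ q, q ∈ κ ↔ ∃ t, κ.orderEmbOfFin h t = q := fun q => by
      rw [← Finset.mem_coe, ← Finset.range_orderEmbOfFin κ h]
      rfl
    ext q
    rw [hmem]
    simp [Fin.exists_fin_succ, eq_comm]

/-- The factor picked up by `ξ_p` when it is contracted onto a crossing of `p`. -/
noncomputable def crossWeight (N : ℕ) {k : ℕ} (p : Finpartition (Finset.univ : Finset (Fin k))) :
    ℂ :=
  (N : ℂ) ^ (Nat.card (Quotient (blockSetoid p)) - 2)

theorem selectMat_mul_vecMat_xi_of_mem_cr (N : ℕ) {k : ℕ}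
    {p : Finpartition (Finset.univ : Finset (Fin k))} {κ : Finset (Fin k)} (h : κ.card = 4)
    (hκ : κ ∈ cr p) :
    selectMat N (κ.orderEmbOfFin h) * vecMat (xi N p) =
      crossWeight N p • vecMat (crossVec N) := by
  obtain ⟨h1, h2, h3⟩ := (isCross_iff h).1 hκ
  rw [selectMat_mul_vecMat_xi, restrictVec_eq_crossVec N h1 h2 h3,
    freeBlocks_of_cross h1 h2 h3, crossWeight]

theorem selectMat_mul_vecMat_xi_mem_NCfam (N : ℕ) {k : ℕ}
    {p : Finpartition (Finset.univ : Finset (Fin k))} {κ : Finset (Fin k)} (h : κ.card = 4)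
    (hκ : κ ∉ cr p) :
    selectMat N (κ.orderEmbOfFin h) * vecMat (xi N p) ∈ NCfam N 0 4 := by
  rw [selectMat_mul_vecMat_xi]
  exact Submodule.smul_mem _ _ (vecMat_restrictVec_mem_NCfam N p _ fun hc =>
    hκ ((isCross_iff h).2 hc))

theorem vecMat_sum_smul {N k : ℕ} {ι : Type*} (s : Finset ι) (α : ι → ℂ)
    (v : ι → (Fin k → Fin N) → ℂ) :
    vecMat (∑ i ∈ s, α i • v i) = ∑ i ∈ s, α i • vecMat (v i) := by
  ext i j
  simp [vecMat, Matrix.sum_apply, Finset.sum_apply]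

theorem vecMat_mem_genNCxi (N : ℕ) {k : ℕ} (ξ : (Fin k → Fin N) → ℂ) :
    vecMat ξ ∈ genNCxi N ξ 0 k := by
  simp only [genNCxi, Submodule.mem_iInf]
  exact fun C _ h => h

theorem genNCxi_le {N k : ℕ} {ξ : (Fin k → Fin N) → ℂ} {C : TKDual N}
    (hC : ∀ a b, NCfam N a b ≤ C.C a b) (hξ : vecMat ξ ∈ C.C 0 k) (k' ℓ' : ℕ) :
    genNCxi N ξ k' ℓ' ≤ C.C k' ℓ' :=
  iInf_le_of_le C (iInf_le_of_le hC (iInf_le _ hξ))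

theorem vecMat_crossVec_mem {N k m : ℕ} (hN : N ≠ 0)
    (p : Fin m → Finpartition (Finset.univ : Finset (Fin k))) (α : Fin m → ℂ)
    (κ : Finset (Fin k)) (hκ : ∀ i, κ ∈ cr (p i)) (j : Fin m) (lam : Finset (Fin k))
    (hlam : ∀ i, i ≠ j → lam ∈ cr (p i)) (hlamj : lam ∉ cr (p j)) (hα : α j ≠ 0) {C : TKDual N}
    (hC : ∀ a b, NCfam N a b ≤ C.C a b) (hξ : vecMat (∑ i, α i • xi N (p i)) ∈ C.C 0 k) :
    vecMat (crossVec N) ∈ C.C 0 4 := by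
  have hsel : ∀ (μ : Finset (Fin k)) (h : μ.card = 4),
      ∑ i, α i • (selectMat N (μ.orderEmbOfFin h) * vecMat (xi N (p i))) ∈ C.C 0 4 := by
    intro μ h
    have := C.comp_mem (hC _ _ (selectMat_mem_NCfam N (μ.orderEmbOfFin h).monotone)) hξ
    rw [vecMat_sum_smul, Matrix.mul_sum] at this
    simpa only [Matrix.mul_smul] using this
  have hall : (∑ i, α i * crossWeight N (p i)) • vecMat (crossVec N) ∈ C.C 0 4 := by
    have h := card_eq_four_of_isCross (hκ j)
    have := hsel κ h
    simp only [selectMat_mul_vecMat_xi_of_mem_cr N h (hκ _), smul_smul] at this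
    rwa [Finset.sum_smul]
  have herase : (∑ i ∈ Finset.univ.erase j, α i * crossWeight N (p i)) • vecMat (crossVec N) ∈
      C.C 0 4 := by
    rcases (Finset.univ.erase j).eq_empty_or_nonempty with he | ⟨i, hi⟩
    · simp [he]
    · have h := card_eq_four_of_isCross (hlam i (Finset.ne_of_mem_erase hi))
      have hs := hsel lam h
      rw [← Finset.sum_erase_add _ _ (Finset.mem_univ j)] at hs
      have hj : α j • (selectMat N (lam.orderEmbOfFin h) * vecMat (xi N (p j))) ∈ C.C 0 4 :=
        Submodule.smul_mem _ _ (hC _ _ (selectMat_mul_vecMat_xi_mem_NCfam N h hlamj))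
      have := (Submodule.add_mem_iff_left _ hj).1 hs
      rw [Finset.sum_smul]
      convert this using 2 with i hi
      rw [selectMat_mul_vecMat_xi_of_mem_cr N h (hlam i (Finset.ne_of_mem_erase hi)), smul_smul]
  rw [← Finset.sum_erase_add _ _ (Finset.mem_univ j), add_smul,
    Submodule.add_mem_iff_right _ herase] at hall
  refine ((C.C 0 4).smul_mem_iff (mul_ne_zero hα ?_)).1 hall
  exact pow_ne_zero _ (Nat.cast_ne_zero.2 hN)

/-- for `N ≥ 4`, distinct partitions `p₁, …, p_m` of `[k]` and nonzero
`ξ = ∑ α_i ξ_{p_i}`, if there is a crossing `κ` common to all `p_i`, and an index `j`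
and a crossing `lam` common to all `p_i`, `i ≠ j`, but not a crossing of `p_j`, then
either `α_j = 0` and `∑_{i ≠ j} α_i ξ_{p_i} ∈ ⟨NC, ξ⟩(0,k)`, or `α_j ≠ 0` and
`⟨NC, ξ⟩ = P`. -/
theorem stmt17 {N k m : ℕ} (hN : 4 ≤ N)
    (p : Fin m → Finpartition (Finset.univ : Finset (Fin k)))
    (hinj : Function.Injective p)
    (α : Fin m → ℂ)
    (ξ : (Fin k → Fin N) → ℂ) (hξ : ξ = ∑ i, α i • xi N (p i)) (hne : ξ ≠ 0)
    (κ : Finset (Fin k)) (hκ : ∀ i, κ ∈ cr (p i))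
    (j : Fin m) (lam : Finset (Fin k))
    (hlam : ∀ i, i ≠ j → lam ∈ cr (p i)) (hlamj : lam ∉ cr (p j)) :
    (α j = 0 ∧ vecMat (∑ i ∈ Finset.univ.erase j, α i • xi N (p i)) ∈ genNCxi N ξ 0 k) ∨
    (α j ≠ 0 ∧ ∀ k' ℓ', genNCxi N ξ k' ℓ' = Pfam N k' ℓ') := by
  by_cases hα : α j = 0
  · refine Or.inl ⟨hα, ?_⟩
    have h : ξ = ∑ i ∈ Finset.univ.erase j, α i • xi N (p i) := by
      rw [hξ, ← Finset.sum_erase_add _ _ (Finset.mem_univ j), hα, zero_smul, add_zero]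
    rw [← h]
    exact vecMat_mem_genNCxi N ξ
  · refine Or.inr ⟨hα, fun k' ℓ' => le_antisymm ?_ ?_⟩
    · rw [← invFam_eq_Pfam]
      refine genNCxi_le (C := invTKDual N) (fun a b => ?_) ?_ k' ℓ'
      · exact (NCfam_le_Pfam N a b).trans (invFam_eq_Pfam N a b).ge
      · change vecMat ξ ∈ invFam N 0 k
        rw [invFam_eq_Pfam, hξ, vecMat_sum_smul]
        exact sum_mem fun i _ => Submodule.smul_mem _ _ (vecMat_xi_mem_Pfam N (p i))
    · refine le_iInf fun C => le_iInf fun hC => le_iInf fun hξC => ?_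
      rw [hξ] at hξC
      exact Pfam_le_of_flip_mem hC (flipMat_mem_of_crossVec_mem hC
        (vecMat_crossVec_mem (by omega) p α κ hκ j lam hlam hlamj hα hC hξC)) k' ℓ'
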